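/- arXiv:math/9906033 — 11 statements merged into one kernel-verified Lean document; each statement's English description precedes it below -/
import Mathlib

section
/- Let V be a set and let 𝓔, 𝓕 be families of finite subsets of V. If for every finite subfamily 𝓔₀ ⊆ 𝓔 and every finite subfamily 𝓕₀ ⊆ 𝓕 the triple ⟨V, 𝓔₀, 𝓕₀⟩ has Property S, then ⟨V, 𝓔, 𝓕⟩ has Property S. -/
/-- `⟨V, 𝓔, 𝓕⟩` has Property S: there is an `X ⊆ V` meeting every member of `𝓔`
whose complement meets every member of `𝓕`. (Here `V` is the whole type.) -/
def HasPropertyS {V : Type*} (𝓔 𝓕 : Set (Set V)) : Prop :=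
  ∃ X : Set V, (∀ E ∈ 𝓔, (X ∩ E).Nonempty) ∧ (∀ F ∈ 𝓕, (Xᶜ ∩ F).Nonempty)

/-- Schrijver's compactness theorem for Property S. -/
theorem propertyS_of_finite_subfamilies {V : Type*} (𝓔 𝓕 : Set (Set V))
    (hE : ∀ E ∈ 𝓔, E.Finite) (hF : ∀ F ∈ 𝓕, F.Finite)
    (h : ∀ 𝓔₀ ⊆ 𝓔, ∀ 𝓕₀ ⊆ 𝓕, 𝓔₀.Finite → 𝓕₀.Finite → HasPropertyS 𝓔₀ 𝓕₀) :
    HasPropertyS 𝓔 𝓕 := by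
  choose X hXE hXF using fun s : Finset (Set V) × Finset (Set V) =>
    h (s.1 ∩ 𝓔) Set.inter_subset_right (s.2 ∩ 𝓕) Set.inter_subset_right
      (s.1.finite_toSet.inter_of_left _) (s.2.finite_toSet.inter_of_left _)
  let U : Ultrafilter (Finset (Set V) × Finset (Set V)) := Ultrafilter.of Filter.atTop
  have hU : (U : Filter (Finset (Set V) × Finset (Set V))) ≤ Filter.atTop := Ultrafilter.of_le _
  refine ⟨{v | ∀ᶠ s in U, v ∈ X s}, fun E hEmem => ?_, fun F hFmem => ?_⟩
  · have hev : ∀ᶠ s in U, ∃ v ∈ E, v ∈ X s := by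
      filter_upwards [hU (Filter.eventually_ge_atTop ({E}, ∅))] with s hs
      obtain ⟨v, hvX, hvE⟩ := hXE s E ⟨Finset.singleton_subset_iff.1 hs.1, hEmem⟩
      exact ⟨v, hvE, hvX⟩
    obtain ⟨v, hvE, hv⟩ := (Ultrafilter.eventually_exists_mem_iff (hE E hEmem)).1 hev
    exact ⟨v, hv, hvE⟩
  · have hev : ∀ᶠ s in U, ∃ v ∈ F, v ∉ X s := by
      filter_upwards [hU (Filter.eventually_ge_atTop (∅, {F}))] with s hs
      obtain ⟨v, hvX, hvF⟩ := hXF s F ⟨Finset.singleton_subset_iff.1 hs.2, hFmem⟩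
      exact ⟨v, hvF, hvX⟩
    obtain ⟨v, hvF, hv⟩ := (Ultrafilter.eventually_exists_mem_iff (hF F hFmem)).1 hev
    exact ⟨v, Ultrafilter.eventually_not.1 hv, hvF⟩
end

section
/- Let 𝓔 and 𝓕 be countable collections of infinite sets and let V = (⋃ 𝓔) ∪ (⋃ 𝓕). Then ⟨V, 𝓔, 𝓕⟩ has Property S. -/
/-- `⟨V, 𝓔, 𝓕⟩` has Property S: there is an `X ⊆ V` meeting every member of `𝓔`
such that `V \ X` meets every member of `𝓕`. -/
def HasPropertySOn {α : Type*} (V : Set α) (𝓔 𝓕 : Set (Set α)) : Prop :=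
  ∃ X ⊆ V, (∀ E ∈ 𝓔, (X ∩ E).Nonempty) ∧ (∀ F ∈ 𝓕, ((V \ X) ∩ F).Nonempty)

/-- A countable family of infinite sets has a system of distinct representatives. -/
theorem exists_injective_forall_mem_of_infinite {ι α : Type*} [Countable ι] (S : ι → Set α)
    (hS : ∀ i, (S i).Infinite) : ∃ f : ι → α, Function.Injective f ∧ ∀ i, f i ∈ S i := by
  classical
  obtain ⟨e, he⟩ := exists_injective_nat ι
  choose T hTS hTc using fun i => (hS i).exists_subset_card_eq (e i + 1)
  have hall : ∀ s : Finset ι, s.card ≤ (s.biUnion T).card := by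
    intro s
    rcases s.eq_empty_or_nonempty with rfl | hs
    · simp
    obtain ⟨i, hi, hmax⟩ := s.exists_max_image e hs
    calc s.card = (s.image e).card := (Finset.card_image_of_injective s he).symm
      _ ≤ (Finset.range (e i + 1)).card := by
        refine Finset.card_le_card (Finset.image_subset_iff.2 fun j hj => ?_)
        exact Finset.mem_range.2 (Nat.lt_succ_of_le (hmax j hj))
      _ = (T i).card := by rw [Finset.card_range, hTc]
      _ ≤ (s.biUnion T).card := Finset.card_le_card (Finset.subset_biUnion_of_mem T hi)
  obtain ⟨f, hf, hfT⟩ := (Finset.all_card_le_biUnion_card_iff_exists_injective T).1 hall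
  exact ⟨f, hf, fun i => hTS i (hfT i)⟩

/-- Countable families of infinite sets have Property S. -/
theorem propertyS_of_countable_infinite {α : Type*} (𝓔 𝓕 : Set (Set α))
    (hEc : 𝓔.Countable) (hFc : 𝓕.Countable)
    (hEi : ∀ A ∈ 𝓔, A.Infinite) (hFi : ∀ B ∈ 𝓕, B.Infinite) :
    HasPropertySOn (⋃₀ 𝓔 ∪ ⋃₀ 𝓕) 𝓔 𝓕 := by
  have := hEc.to_subtype
  have := hFc.to_subtype
  obtain ⟨f, hf, hfS⟩ := exists_injective_forall_mem_of_infinite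
    (Sum.elim (fun E : 𝓔 => (E : Set α)) (fun F : 𝓕 => (F : Set α)))
    (by rintro (E | F); exacts [hEi E E.2, hFi F F.2])
  refine ⟨Set.range (f ∘ Sum.inl), ?_, fun E hE => ?_, fun F hF => ?_⟩
  · rintro _ ⟨E, rfl⟩
    exact Or.inl ⟨E, E.2, hfS (Sum.inl E)⟩
  · exact ⟨f (Sum.inl ⟨E, hE⟩), ⟨⟨E, hE⟩, rfl⟩, hfS (Sum.inl ⟨E, hE⟩)⟩
  · have hmem : f (Sum.inr ⟨F, hF⟩) ∈ F := hfS (Sum.inr ⟨F, hF⟩)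
    refine ⟨f (Sum.inr ⟨F, hF⟩), ⟨Or.inr ⟨F, hF, hmem⟩, ?_⟩, hmem⟩
    rintro ⟨E, hE⟩
    exact Sum.inl_ne_inr (hf hE)
end

section
/- Let V be a finite set and let 𝓔, 𝓕 be families of nonempty subsets of V. If the number of sets in 𝓘(𝓔) ∪ 𝓘(𝓕) is strictly less than 2^(|V|−1), then ⟨V, 𝓔, 𝓕⟩ has Property S. -/
/-- `𝓘(𝓐)`: all subsets of `V` containing some member of `𝓐`. -/
def upFamily {V : Type*} (𝓐 : Set (Set V)) : Set (Set V) :=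
  {Y | ∃ a ∈ 𝓐, a ⊆ Y}

/-- A family containing `X` or `Xᶜ` for every `X` has at least half of all subsets. -/
theorem two_pow_card_le_two_mul_ncard {V : Type*} [Fintype V] {𝓤 : Set (Set V)}
    (h : ∀ X : Set V, X ∈ 𝓤 ∨ Xᶜ ∈ 𝓤) : 2 ^ Fintype.card V ≤ 2 * 𝓤.ncard := by
  have huniv : 𝓤 ∪ compl '' 𝓤 = Set.univ :=
    Set.eq_univ_of_forall fun X => (h X).imp id fun hX => ⟨Xᶜ, hX, compl_compl X⟩
  calc 2 ^ Fintype.card V = (Set.univ : Set (Set V)).ncard := by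
        rw [Set.ncard_univ, Nat.card_eq_fintype_card, Fintype.card_set]
    _ = (𝓤 ∪ compl '' 𝓤).ncard := by rw [huniv]
    _ ≤ 𝓤.ncard + (compl '' 𝓤).ncard := Set.ncard_union_le _ _
    _ = 2 * 𝓤.ncard := by rw [Set.ncard_image_of_injective _ compl_injective, two_mul]

/-- If `|𝓘(𝓔) ∪ 𝓘(𝓕)| < 2^(|V|-1)` then `⟨V, 𝓔, 𝓕⟩` has Property S. -/
theorem propertyS_of_upFamily_card_lt {V : Type*} [Fintype V] (𝓔 𝓕 : Set (Set V))
    (hE : ∀ E ∈ 𝓔, E.Nonempty) (hF : ∀ F ∈ 𝓕, F.Nonempty)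
    (hcard : (upFamily 𝓔 ∪ upFamily 𝓕).ncard < 2 ^ (Fintype.card V - 1)) :
    HasPropertyS 𝓔 𝓕 := by
  by_contra hS
  have cover : ∀ X : Set V, X ∈ upFamily 𝓔 ∪ upFamily 𝓕 ∨ Xᶜ ∈ upFamily 𝓔 ∪ upFamily 𝓕 := by
    intro X
    by_contra! hX
    obtain ⟨hX, hXc⟩ := hX
    refine hS ⟨X, fun E hE => ?_, fun F hF => ?_⟩
    · by_contra hne
      rw [Set.not_nonempty_iff_eq_empty, ← Set.disjoint_iff_inter_eq_empty] at hne
      exact hXc (.inl ⟨E, hE, hne.subset_compl_left⟩)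
    · by_contra hne
      rw [Set.not_nonempty_iff_eq_empty, ← Set.disjoint_iff_inter_eq_empty] at hne
      exact hX (.inr ⟨F, hF, Set.disjoint_compl_left_iff_subset.mp hne⟩)
  have := two_pow_card_le_two_mul_ncard cover
  rcases Nat.eq_zero_or_pos (Fintype.card V) with h | h
  · simp only [h, Nat.zero_sub, pow_zero] at hcard this
    omega
  · have := mul_pow_sub_one h.ne' 2
    omega
end

section
/- Let V be a finite set and let 𝓔, 𝓕 be families of subsets of V. If the sum over all sets A in the family 𝓔 ∪ 𝓕 (each distinct set counted once) of 1/2^|A| is strictly less than 1/2, then ⟨V, 𝓔, 𝓕⟩ has Property S. -/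
/-- `⟨V, 𝓔, 𝓕⟩` has Property S (finite version): there is an `X ⊆ V` meeting every
member of `𝓔` whose complement meets every member of `𝓕`. -/
def HasPropertySF {V : Type*} [Fintype V] [DecidableEq V] (𝓔 𝓕 : Finset (Finset V)) : Prop :=
  ∃ X : Finset V, (∀ E ∈ 𝓔, (X ∩ E).Nonempty) ∧ (∀ F ∈ 𝓕, (Xᶜ ∩ F).Nonempty)

/-- At most `2 · 2^(|V| - |A|)` sets are disjoint from `A` or contain `A`. -/
theorem card_powerset_compl_union_Icc_le {V : Type*} [Fintype V] [DecidableEq V] (A : Finset V) :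
    (((Aᶜ.powerset ∪ Finset.Icc A Finset.univ).card : ℕ) : ℝ) ≤
      2 ^ Fintype.card V * 2 * (1 / 2 ^ A.card) := by
  have hA : A.card ≤ Fintype.card V := A.card_le_univ
  have hcard : (Aᶜ.powerset ∪ Finset.Icc A Finset.univ).card ≤
      2 * 2 ^ (Fintype.card V - A.card) := by
    refine (Finset.card_union_le _ _).trans_eq ?_
    rw [Finset.card_powerset, Finset.card_compl, Finset.card_Icc_finset A.subset_univ,
      Finset.card_univ, two_mul]
  calc (((Aᶜ.powerset ∪ Finset.Icc A Finset.univ).card : ℕ) : ℝ)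
      ≤ 2 * 2 ^ (Fintype.card V - A.card) := by exact_mod_cast hcard
    _ = 2 ^ Fintype.card V * 2 * (1 / 2 ^ A.card) := by
      rw [pow_sub₀ _ two_ne_zero hA]
      ring

/-- If `∑_{A ∈ 𝓔 ∪ 𝓕} 1/2^|A| < 1/2` then `⟨V, 𝓔, 𝓕⟩` has Property S. -/
theorem propertyS_of_sum_lt {V : Type*} [Fintype V] [DecidableEq V]
    (𝓔 𝓕 : Finset (Finset V))
    (h : ∑ A ∈ 𝓔 ∪ 𝓕, (1 : ℝ) / 2 ^ A.card < 1 / 2) :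
    HasPropertySF 𝓔 𝓕 := by
  by_contra hS
  have hcover : (Finset.univ : Finset (Finset V)) ⊆
      (𝓔 ∪ 𝓕).biUnion fun A => Aᶜ.powerset ∪ Finset.Icc A Finset.univ := by
    intro X _
    by_contra hX
    simp only [Finset.mem_biUnion, Finset.mem_union, Finset.mem_powerset, Finset.mem_Icc,
      not_exists, not_and, not_or] at hX
    refine hS ⟨X, fun E hE => ?_, fun F hF => ?_⟩
    · rw [← Finset.not_disjoint_iff_nonempty_inter]
      exact fun hd => (hX E (Or.inl hE)).1 (Finset.subset_compl_iff_disjoint_right.2 hd)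
    · rw [← Finset.not_disjoint_iff_nonempty_inter]
      exact fun hd => (hX F (Or.inr hF)).2
        (disjoint_compl_left_iff.1 hd) (Finset.subset_univ X)
  have hcard := (Finset.card_le_card hcover).trans Finset.card_biUnion_le
  rw [Finset.card_univ, Fintype.card_finset] at hcard
  have hsum : (2 : ℝ) ^ Fintype.card V ≤
      2 ^ Fintype.card V * 2 * ∑ A ∈ 𝓔 ∪ 𝓕, (1 : ℝ) / 2 ^ A.card := by
    rw [Finset.mul_sum]
    refine le_trans ?_ (Finset.sum_le_sum fun A _ => card_powerset_compl_union_Icc_le A)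
    exact_mod_cast hcard
  have hpos : (0 : ℝ) < 2 ^ Fintype.card V := by positivity
  nlinarith
end

section
/- If 𝓕 is a family of subsets of a finite set V and the sum over all A ∈ 𝓕 of 1/2^|A| is strictly less than 1/2, then 𝓕 has Property B. -/
/-- `𝓕` has Property B (finite version): there is an `X` such that both `X` and its
complement meet every member of `𝓕`. -/
def HasPropertyBF {V : Type*} [Fintype V] [DecidableEq V] (𝓕 : Finset (Finset V)) : Prop :=
  ∃ X : Finset V, ∀ A ∈ 𝓕, (X ∩ A).Nonempty ∧ (Xᶜ ∩ A).Nonempty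

/-- At most `2 * 2 ^ (|V| - |A|)` sets `X` fail to split `A`, i.e. miss `A` or contain it. -/
theorem card_not_splitting_le {V : Type*} [Fintype V] [DecidableEq V] (A : Finset V) :
    (((Aᶜ.powerset ∪ Aᶜ.powerset.image compl).card : ℕ) : ℝ) ≤
      2 * 2 ^ Fintype.card V * (1 / 2 ^ A.card) := by
  have hle : (Aᶜ.powerset ∪ Aᶜ.powerset.image compl).card ≤ 2 * 2 ^ Aᶜ.card := by
    refine (Finset.card_union_le _ _).trans ?_
    have := Finset.card_image_le (s := Aᶜ.powerset) (f := compl)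
    rw [Finset.card_powerset] at *
    omega
  have hpow : (2 : ℝ) ^ Fintype.card V = 2 ^ A.card * 2 ^ Aᶜ.card := by
    rw [← pow_add, Finset.card_add_card_compl]
  calc _ ≤ (2 : ℝ) * 2 ^ Aᶜ.card := by exact_mod_cast hle
    _ = _ := by rw [hpow]; field_simp

/-- If `∑_{A ∈ 𝓕} 1/2^|A| < 1/2` then `𝓕` has Property B. -/
theorem propertyB_of_sum_lt {V : Type*} [Fintype V] [DecidableEq V]
    (𝓕 : Finset (Finset V))
    (h : ∑ A ∈ 𝓕, (1 : ℝ) / 2 ^ A.card < 1 / 2) :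
    HasPropertyBF 𝓕 := by
  have hcard : (𝓕.biUnion fun A => Aᶜ.powerset ∪ Aᶜ.powerset.image compl).card <
      (Finset.univ : Finset (Finset V)).card := by
    rw [Finset.card_univ, Fintype.card_finset]
    have hpos : (0 : ℝ) < 2 ^ Fintype.card V := by positivity
    have hreal : ((𝓕.biUnion fun A => Aᶜ.powerset ∪ Aᶜ.powerset.image compl).card : ℝ) <
        2 ^ Fintype.card V := by
      calc _ ≤ ∑ A ∈ 𝓕, ((Aᶜ.powerset ∪ Aᶜ.powerset.image compl).card : ℝ) := by
            exact_mod_cast Finset.card_biUnion_le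
        _ ≤ ∑ A ∈ 𝓕, 2 * 2 ^ Fintype.card V * ((1 : ℝ) / 2 ^ A.card) :=
            Finset.sum_le_sum fun A _ => card_not_splitting_le A
        _ = 2 * 2 ^ Fintype.card V * ∑ A ∈ 𝓕, (1 : ℝ) / 2 ^ A.card := by
            rw [Finset.mul_sum]
        _ < 2 ^ Fintype.card V := by nlinarith
    exact_mod_cast hreal
  obtain ⟨X, -, hX⟩ := Finset.exists_mem_notMem_of_card_lt_card hcard
  refine ⟨X, fun A hA => ?_⟩
  simp only [Finset.mem_biUnion, not_exists, not_and, Finset.mem_union, not_or] at hX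
  obtain ⟨hmiss, hcontain⟩ := hX A hA
  constructor
  · rw [← Finset.not_disjoint_iff_nonempty_inter]
    exact fun hd => hmiss (Finset.mem_powerset.2 (le_compl_iff_disjoint_right.2 hd))
  · rw [← Finset.not_disjoint_iff_nonempty_inter]
    exact fun hd => hcontain (Finset.mem_image.2
      ⟨Xᶜ, Finset.mem_powerset.2 (le_compl_iff_disjoint_right.2 hd), compl_compl X⟩)
end

section
/- Let V be a set and let 𝓔, 𝓕 be families of finite subsets of V. Then ⟨V, 𝓔, 𝓕⟩ fails to have Property S if and only if the empty set belongs to [𝓔]_𝓕, the closure of 𝓔 under resolution on members of 𝓕. -/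
/-- The closure of `𝓐` under resolution on members of `𝓓`: the smallest family
containing `𝓐` such that whenever `d ∈ 𝓓` and for each `v ∈ d` we have a set
`c v` in the closure with `v ∈ c v`, the resolvent `⋃ v ∈ d, c v \ {v}` is
also in the closure. -/
inductive ResClosure {V : Type*} (𝓐 𝓓 : Set (Set V)) : Set V → Prop
  | base {c : Set V} (hc : c ∈ 𝓐) : ResClosure 𝓐 𝓓 c
  | res {d : Set V} (hd : d ∈ 𝓓) (c : V → Set V)
      (hmem : ∀ v ∈ d, v ∈ c v) (hcl : ∀ v ∈ d, ResClosure 𝓐 𝓓 (c v)) :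
      ResClosure 𝓐 𝓓 (⋃ v ∈ d, c v \ {v})

/-- `[𝓐]_𝓓`, the resolution closure as a family of sets. -/
def resSet {V : Type*} (𝓐 𝓓 : Set (Set V)) : Set (Set V) :=
  {e | ResClosure 𝓐 𝓓 e}

theorem ResClosure.inter_nonempty {V : Type*} {𝓐 𝓓 : Set (Set V)} {X e : Set V}
    (hA : ∀ A ∈ 𝓐, (X ∩ A).Nonempty) (hD : ∀ D ∈ 𝓓, (Xᶜ ∩ D).Nonempty)
    (he : ResClosure 𝓐 𝓓 e) : (X ∩ e).Nonempty := by
  induction he with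
  | base hc => exact hA _ hc
  | res hd c hmem hcl ih =>
    obtain ⟨v, hvX, hvd⟩ := hD _ hd
    obtain ⟨w, hwX, hwc⟩ := ih v hvd
    refine ⟨w, hwX, Set.mem_biUnion hvd ⟨hwc, ?_⟩⟩
    rintro rfl
    exact hvX hwX

theorem ResClosure.finite {V : Type*} {𝓐 𝓓 : Set (Set V)} {e : Set V}
    (hA : ∀ A ∈ 𝓐, A.Finite) (hD : ∀ D ∈ 𝓓, D.Finite)
    (he : ResClosure 𝓐 𝓓 e) : e.Finite := by
  induction he with
  | base hc => exact hA _ hc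
  | res hd c hmem hcl ih => exact (hD _ hd).biUnion fun v hv => (ih v hv).sdiff

/-- A family of nonempty finite sets admits a maximal set containing none of its members. -/
theorem exists_maximal_forall_not_subset {V : Type*} {𝓒 : Set (Set V)}
    (hfin : ∀ e ∈ 𝓒, e.Finite) (hne : ∅ ∉ 𝓒) :
    ∃ Y : Set V, Maximal (fun Y => ∀ e ∈ 𝓒, ¬ e ⊆ Y) Y := by
  obtain ⟨Y, -, hY⟩ := zorn_subset_nonempty {Y : Set V | ∀ e ∈ 𝓒, ¬ e ⊆ Y}
    (fun c hc hchain hcne => ⟨⋃₀ c, fun e he hsub => by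
      obtain ⟨Z, hZ, heZ⟩ := hchain.directedOn.exists_mem_subset_of_finite_of_subset_sUnion
        hcne (hfin e he) hsub
      exact hc hZ e he heZ, fun _ => Set.subset_sUnion_of_mem⟩)
    ∅ (fun e he hsub => hne (Set.subset_empty_iff.mp hsub ▸ he))
  exact ⟨Y, hY⟩

/-- Kolany's theorem: `⟨V, 𝓔, 𝓕⟩` fails to have Property S iff `∅ ∈ [𝓔]_𝓕`. -/
theorem not_propertyS_iff_empty_mem_resSet {V : Type*} (𝓔 𝓕 : Set (Set V))
    (hE : ∀ E ∈ 𝓔, E.Finite) (hF : ∀ F ∈ 𝓕, F.Finite) :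
    ¬ HasPropertyS 𝓔 𝓕 ↔ ∅ ∈ resSet 𝓔 𝓕 := by
  refine ⟨fun hS => ?_, fun hempty ⟨X, hXE, hXF⟩ => ?_⟩
  · by_contra hempty
    obtain ⟨Y, hY⟩ := exists_maximal_forall_not_subset
      (fun e (he : e ∈ resSet 𝓔 𝓕) => ResClosure.finite hE hF he) hempty
    have hres : ∀ v, v ∉ Y → ∃ e, ResClosure 𝓔 𝓕 e ∧ e ⊆ insert v Y := by
      intro v hv
      by_contra! h
      exact hv (hY.2 h (Set.subset_insert v Y) (Set.mem_insert v Y))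
    choose! c hc hcY using hres
    refine hS ⟨Yᶜ, fun E hEmem => ?_, fun F hFmem => ?_⟩
    · obtain ⟨v, hvE, hvY⟩ := Set.not_subset.mp (hY.1 E (.base hEmem))
      exact ⟨v, hvY, hvE⟩
    · by_contra hdisj
      have hFY : ∀ v ∈ F, v ∉ Y := fun v hvF hvY =>
        hdisj ⟨v, not_not.mpr hvY, hvF⟩
      have hmem : ∀ v ∈ F, v ∈ c v := fun v hvF => by
        by_contra hv
        exact hY.1 _ (hc v (hFY v hvF))
          ((Set.subset_insert_iff_of_notMem hv).mp (hcY v (hFY v hvF)))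
      exact hY.1 _ (.res hFmem c hmem fun v hvF => hc v (hFY v hvF))
        (Set.iUnion₂_subset fun v hvF => Set.sdiff_singleton_subset_iff.mpr (hcY v (hFY v hvF)))
  · exact (ResClosure.inter_nonempty hXE hXF hempty).ne_empty (Set.inter_empty X)
end

section
/- Let V be a set and let 𝓔, 𝓕 be families of finite subsets of V. Then ⟨V, 𝓔, 𝓕⟩ has Property S if and only if ⟨V, [𝓔]_𝓕, 𝓕⟩ has Property S. -/
/-- `⟨V, 𝓔, 𝓕⟩` has Property S iff `⟨V, [𝓔]_𝓕, 𝓕⟩` has Property S. -/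
theorem propertyS_iff_propertyS_resSet {V : Type*} (𝓔 𝓕 : Set (Set V))
    (hE : ∀ E ∈ 𝓔, E.Finite) (hF : ∀ F ∈ 𝓕, F.Finite) :
    HasPropertyS 𝓔 𝓕 ↔ HasPropertyS (resSet 𝓔 𝓕) 𝓕 := by
  constructor
  · rintro ⟨X, hXE, hXF⟩
    exact ⟨X, fun _ he => ResClosure.inter_nonempty hXE hXF he, hXF⟩
  · rintro ⟨X, hXE, hXF⟩
    exact ⟨X, fun E hE => hXE E (ResClosure.base hE), hXF⟩
end

section
/- Let Var be a type of propositional variables, let a literal be a pair (p, b) with p ∈ Var and b ∈ Bool (b = true for the positive literal p, b = false for its negation), and let 𝓒 be a set of clauses, each clause a subset of Var × Bool. Let V = Var × Bool, let 𝓔 = 𝓒, and let 𝓕 = { {(p, true), (p, false)} : p ∈ Var }. Then 𝓒 is satisfiable — that is, there exists τ : Var → Bool such that every clause c ∈ 𝓒 contains a literal (p, b) with τ(p) = b — if and only if ⟨V, 𝓔, 𝓕⟩ has Property S. -/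
/-- A set `𝓒` of clauses (sets of literals, i.e. of pairs `(p, b) : Var × Bool`)
is satisfiable iff `⟨Var × Bool, 𝓒, { {(p,true),(p,false)} : p ∈ Var }⟩` has
Property S. -/
theorem satisfiable_iff_propertyS {Var : Type*} (𝓒 : Set (Set (Var × Bool))) :
    (∃ τ : Var → Bool, ∀ c ∈ 𝓒, ∃ l ∈ c, τ l.1 = l.2) ↔
      HasPropertyS 𝓒
        {F | ∃ p : Var, F = ({(p, true), (p, false)} : Set (Var × Bool))} := by
  classical
  constructor
  · rintro ⟨τ, hτ⟩
    refine ⟨{l | τ l.1 = l.2}, fun c hc => ?_, ?_⟩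
    · obtain ⟨l, hl, h⟩ := hτ c hc
      exact ⟨l, h, hl⟩
    · rintro _ ⟨p, rfl⟩
      refine ⟨(p, !τ p), ?_, ?_⟩
      · simp
      · cases τ p <;> simp
  · rintro ⟨X, hE, hF⟩
    refine ⟨fun p => decide ((p, true) ∈ X), fun c hc => ?_⟩
    obtain ⟨⟨p, b⟩, hX, hl⟩ := hE c hc
    refine ⟨(p, b), hl, ?_⟩
    cases b with
    | true => simpa using hX
    | false =>
      obtain ⟨l, hlX, rfl | rfl⟩ := hF _ ⟨p, rfl⟩
      · simpa using hlX
      · exact absurd hX hlX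
end

section
/- Let G be a simple graph on vertex set A and let n be a natural number. Let V = A × Fin n, let 𝓔 = { {(a, j) : j ∈ Fin n} : a ∈ A }, and let 𝓕 = { {(a₁, i), (a₂, i)} : a₁ and a₂ adjacent in G, i ∈ Fin n }. Then G is n-colorable if and only if ⟨V, 𝓔, 𝓕⟩ has Property S. -/
/-- A graph `G` is `n`-colorable iff the associated bihypergraph on `A × Fin n`
has Property S. -/
theorem colorable_iff_propertyS {A : Type*} (G : SimpleGraph A) (n : ℕ) :
    (∃ f : A → Fin n, ∀ a₁ a₂ : A, G.Adj a₁ a₂ → f a₁ ≠ f a₂) ↔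
      HasPropertyS
        {E : Set (A × Fin n) | ∃ a : A, E = {x | x.1 = a}}
        {F : Set (A × Fin n) |
          ∃ a₁ a₂ : A, ∃ i : Fin n, G.Adj a₁ a₂ ∧ F = {(a₁, i), (a₂, i)}} := by
  constructor
  · rintro ⟨f, hf⟩
    refine ⟨{x | f x.1 = x.2}, ?_, ?_⟩
    · rintro _ ⟨a, rfl⟩
      exact ⟨(a, f a), rfl, rfl⟩
    · rintro _ ⟨a₁, a₂, i, hadj, rfl⟩
      by_cases h : f a₁ = i
      · exact ⟨(a₂, i), fun h₂ => hf a₁ a₂ hadj (h.trans h₂.symm), Or.inr rfl⟩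
      · exact ⟨(a₁, i), h, Or.inl rfl⟩
  · rintro ⟨X, hE, hF⟩
    have hX : ∀ a, ∃ i, (a, i) ∈ X := by
      intro a
      obtain ⟨⟨_, i⟩, hx, rfl⟩ := hE _ ⟨a, rfl⟩
      exact ⟨i, hx⟩
    choose f hf using hX
    refine ⟨f, fun a₁ a₂ hadj heq => ?_⟩
    obtain ⟨_, hx, rfl | rfl⟩ := hF _ ⟨a₁, a₂, f a₁, hadj, rfl⟩
    · exact hx (hf a₁)
    · exact hx (heq ▸ hf a₂)
end

section
/- Let G be a simple graph on vertex set A and let L assign to each vertex a ∈ A a set L(a) of colors. Let V = { (a, i) : a ∈ A, i ∈ L(a) }, let 𝓔 = { {(a, i) : i ∈ L(a)} : a ∈ A }, and let 𝓕 = { {(a₁, i), (a₂, i)} : a₁ and a₂ adjacent in G, i ∈ L(a₁) ∩ L(a₂) }. Then G is L-list colorable if and only if ⟨V, 𝓔, 𝓕⟩ has Property S. -/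
/-- A graph `G` is `L`-list colorable iff the associated bihypergraph on
`V = {(a, i) | i ∈ L a}` has Property S. -/
theorem listColorable_iff_propertyS {A β : Type*} (G : SimpleGraph A) (L : A → Set β) :
    (∃ f : A → β, (∀ a : A, f a ∈ L a) ∧ ∀ a₁ a₂ : A, G.Adj a₁ a₂ → f a₁ ≠ f a₂) ↔
      HasPropertySOn
        {p : A × β | p.2 ∈ L p.1}
        {E : Set (A × β) | ∃ a : A, E = {p | p.1 = a ∧ p.2 ∈ L a}}
        {F : Set (A × β) |
          ∃ a₁ a₂ : A, ∃ i : β,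
            G.Adj a₁ a₂ ∧ i ∈ L a₁ ∧ i ∈ L a₂ ∧ F = {(a₁, i), (a₂, i)}} := by
  constructor
  · rintro ⟨f, hfL, hf⟩
    refine ⟨{p | p.2 = f p.1}, ?_, ?_, ?_⟩
    · rintro ⟨a, i⟩ (rfl : i = f a)
      exact hfL a
    · rintro _ ⟨a, rfl⟩
      exact ⟨(a, f a), rfl, rfl, hfL a⟩
    · rintro _ ⟨a₁, a₂, i, hadj, h₁, h₂, rfl⟩
      by_cases h : i = f a₁
      · exact ⟨(a₂, i), ⟨h₂, fun h' => hf a₁ a₂ hadj (h.symm.trans h')⟩, Or.inr rfl⟩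
      · exact ⟨(a₁, i), ⟨h₁, h⟩, Or.inl rfl⟩
  · rintro ⟨X, -, hE, hF⟩
    have hchoice : ∀ a, ∃ i ∈ L a, (a, i) ∈ X := by
      intro a
      obtain ⟨⟨_, i⟩, hX, rfl, hi⟩ := hE _ ⟨a, rfl⟩
      exact ⟨i, hi, hX⟩
    choose f hfL hfX using hchoice
    refine ⟨f, hfL, fun a₁ a₂ hadj heq => ?_⟩
    obtain ⟨p, ⟨-, hpX⟩, rfl | rfl⟩ :=
      hF _ ⟨a₁, a₂, f a₁, hadj, hfL a₁, heq ▸ hfL a₂, rfl⟩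
    · exact hpX (hfX a₁)
    · exact hpX (heq ▸ hfX a₂)
end

section
/- Let S = (Sᵢ)_{i ∈ I} be an indexed family of sets. Let V = { (s, i) : i ∈ I, s ∈ Sᵢ }, let 𝓔 = { {(s, i) : s ∈ Sᵢ} : i ∈ I }, and let 𝓕 = { {(s, i), (s, j)} : i ≠ j, s ∈ Sᵢ ∩ Sⱼ }. Then S has a system of distinct representatives if and only if ⟨V, 𝓔, 𝓕⟩ has Property S. -/
/-- The marriage problem: the family `S` has a system of distinct representatives
iff the associated bihypergraph on `V = {(s, i) | s ∈ S i}` has Property S. -/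
theorem sdr_iff_propertyS {α I : Type*} (S : I → Set α) :
    (∃ f : I → α, Function.Injective f ∧ ∀ i : I, f i ∈ S i) ↔
      HasPropertySOn
        {p : α × I | p.1 ∈ S p.2}
        {E : Set (α × I) | ∃ i : I, E = {p | p.2 = i ∧ p.1 ∈ S i}}
        {F : Set (α × I) |
          ∃ s : α, ∃ i j : I,
            i ≠ j ∧ s ∈ S i ∧ s ∈ S j ∧ F = {(s, i), (s, j)}} := by
  constructor
  · rintro ⟨f, hf, hfS⟩
    refine ⟨{p | p.1 = f p.2}, ?_, ?_, ?_⟩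
    · rintro ⟨s, i⟩ (h : s = f i)
      exact h ▸ hfS i
    · rintro _ ⟨i, rfl⟩
      exact ⟨(f i, i), rfl, rfl, hfS i⟩
    · rintro _ ⟨s, i, j, hij, hi, hj, rfl⟩
      by_cases h : s = f i
      · exact ⟨(s, j), ⟨hj, fun h' => hij (hf (h.symm.trans h'))⟩, Or.inr rfl⟩
      · exact ⟨(s, i), ⟨hi, h⟩, Or.inl rfl⟩
  · rintro ⟨X, -, hE, hF⟩
    have hX : ∀ i, ∃ s, (s, i) ∈ X ∧ s ∈ S i := by
      intro i
      obtain ⟨⟨s, _⟩, hs, rfl, hsS⟩ := hE _ ⟨i, rfl⟩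
      exact ⟨s, hs, hsS⟩
    choose f hfX hfS using hX
    refine ⟨f, fun i j hij => ?_, hfS⟩
    by_contra hne
    obtain ⟨p, ⟨-, hp⟩, rfl | rfl⟩ := hF _ ⟨f i, i, j, hne, hfS i, hij ▸ hfS j, rfl⟩
    · exact hp (hfX i)
    · exact hp (hij ▸ hfX j)
end
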